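/- There exists a generative grammar G = (N, Σ, P, s), all of whose productions have non-empty left- and right-hand sides, such that the language generated by G is algorithmically undecidable, i.e., the predicate 'ω belongs to the language generated by G' on words ω over Σ is not a computable (decidable) predicate. -/

import Mathlib

namespace Lambek

/-! ## Formulae of `!bL1` (Lambek calculus with unit, brackets and subexponential) -/

/-- Formulae: primitive types, the unit `1`, `\`, `/`, `·`, `⟨⟩`, `[]⁻¹`, `!`. -/
inductive Fm : Type
  | var : ℕ → Fm
  | one : Fm
  | ldiv : Fm → Fm → Fm   -- `ldiv A C` is `A \ C`
  | rdiv : Fm → Fm → Fm   -- `rdiv C B` is `C / B`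
  | mul : Fm → Fm → Fm    -- `A · B`
  | dia : Fm → Fm         -- `⟨⟩ A`
  | binv : Fm → Fm        -- `[]⁻¹ A`
  | bang : Fm → Fm        -- `! A`

/-- Items of a meta-formula: a formula or a bracketed meta-formula. -/
inductive Item : Type
  | fm : Fm → Item
  | br : List Item → Item

/-- Meta-formulae (configurations): finite ordered sequences of items. -/
abbrev Meta := List Item

/-- `!A₁, …, !Aₙ` as a meta-formula. -/
def bangs (Φ : List Fm) : Meta := Φ.map (fun F => Item.fm (Fm.bang F))

/-- A meta-formula with a designated (hole) occurrence of a meta-formula,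
possibly under nested brackets. -/
inductive Ctx : Type
  | hole : Meta → Meta → Ctx
  | br : Meta → Ctx → Meta → Ctx

/-- Plug a meta-formula into the designated occurrence. -/
def Ctx.fill : Ctx → Meta → Meta
  | Ctx.hole Δ₁ Δ₂, Γ => Δ₁ ++ Γ ++ Δ₂
  | Ctx.br Δ₁ c Δ₂, Γ => Δ₁ ++ (Item.br (c.fill Γ)) :: Δ₂

/-- Derivability in `!bL1`.  The boolean parameter says whether the rule (cut)
is allowed: `DervB true` is full `!bL1`, `DervB false` is cut-free derivability. -/
inductive DervB : Bool → Meta → Fm → Prop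
  | id (cf : Bool) (A : Fm) : DervB cf [Item.fm A] A
  | one_r (cf : Bool) : DervB cf [] Fm.one
  | rdiv_l (cf : Bool) (Δ : Ctx) (Γ : Meta) (B C D : Fm) :
      DervB cf Γ B → DervB cf (Δ.fill [Item.fm C]) D →
      DervB cf (Δ.fill (Item.fm (Fm.rdiv C B) :: Γ)) D
  | rdiv_r (cf : Bool) (Γ : Meta) (B C : Fm) :
      DervB cf (Γ ++ [Item.fm B]) C → DervB cf Γ (Fm.rdiv C B)
  | ldiv_l (cf : Bool) (Δ : Ctx) (Γ : Meta) (A C D : Fm) :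
      DervB cf Γ A → DervB cf (Δ.fill [Item.fm C]) D →
      DervB cf (Δ.fill (Γ ++ [Item.fm (Fm.ldiv A C)])) D
  | ldiv_r (cf : Bool) (Γ : Meta) (A C : Fm) :
      DervB cf (Item.fm A :: Γ) C → DervB cf Γ (Fm.ldiv A C)
  | mul_l (cf : Bool) (Δ : Ctx) (A B D : Fm) :
      DervB cf (Δ.fill [Item.fm A, Item.fm B]) D →
      DervB cf (Δ.fill [Item.fm (Fm.mul A B)]) D
  | mul_r (cf : Bool) (Γ₁ Γ₂ : Meta) (A B : Fm) :
      DervB cf Γ₁ A → DervB cf Γ₂ B → DervB cf (Γ₁ ++ Γ₂) (Fm.mul A B)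
  | one_l (cf : Bool) (Δ : Ctx) (A : Fm) :
      DervB cf (Δ.fill []) A → DervB cf (Δ.fill [Item.fm Fm.one]) A
  | dia_l (cf : Bool) (Δ : Ctx) (A C : Fm) :
      DervB cf (Δ.fill [Item.br [Item.fm A]]) C →
      DervB cf (Δ.fill [Item.fm (Fm.dia A)]) C
  | dia_r (cf : Bool) (Θ : Meta) (A : Fm) :
      DervB cf Θ A → DervB cf [Item.br Θ] (Fm.dia A)
  | binv_l (cf : Bool) (Δ : Ctx) (A C : Fm) :
      DervB cf (Δ.fill [Item.fm A]) C →
      DervB cf (Δ.fill [Item.br [Item.fm (Fm.binv A)]]) C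
  | binv_r (cf : Bool) (Θ : Meta) (A : Fm) :
      DervB cf [Item.br Θ] A → DervB cf Θ (Fm.binv A)
  | bang_l (cf : Bool) (Δ : Ctx) (A B : Fm) :
      DervB cf (Δ.fill [Item.fm A]) B → DervB cf (Δ.fill [Item.fm (Fm.bang A)]) B
  | bang_r (cf : Bool) (Φ : List Fm) (A : Fm) :
      DervB cf (bangs Φ) A → DervB cf (bangs Φ) (Fm.bang A)
  | contr (cf : Bool) (Δ : Ctx) (Φ : List Fm) (Γ : Meta) (B : Fm) :
      Φ ≠ [] →
      DervB cf (Δ.fill (bangs Φ ++ [Item.br (bangs Φ ++ Γ)])) B →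
      DervB cf (Δ.fill (bangs Φ ++ Γ)) B
  | perm1 (cf : Bool) (Δ : Ctx) (A : Fm) (Γ : Meta) (B : Fm) :
      DervB cf (Δ.fill (Item.fm (Fm.bang A) :: Γ)) B →
      DervB cf (Δ.fill (Γ ++ [Item.fm (Fm.bang A)])) B
  | perm2 (cf : Bool) (Δ : Ctx) (A : Fm) (Γ : Meta) (B : Fm) :
      DervB cf (Δ.fill (Γ ++ [Item.fm (Fm.bang A)])) B →
      DervB cf (Δ.fill (Item.fm (Fm.bang A) :: Γ)) B
  | cut (Δ : Ctx) (Θ : Meta) (A C : Fm) :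
      DervB true Θ A → DervB true (Δ.fill [Item.fm A]) C →
      DervB true (Δ.fill Θ) C

/-! ## Bracket-free formulae and the calculi `!L1` and `!wL1` -/

/-- Bracket-free formulae (language of `!L1` / `!wL1`). -/
inductive Fm0 : Type
  | var : ℕ → Fm0
  | one : Fm0
  | ldiv : Fm0 → Fm0 → Fm0
  | rdiv : Fm0 → Fm0 → Fm0
  | mul : Fm0 → Fm0 → Fm0
  | bang : Fm0 → Fm0

/-- Derivability in `!L1` / `!wL1`.  The first boolean allows the weakening
rule (`DervL true` is `!wL1`, `DervL false` is `!L1`); the second boolean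
allows the rule (cut). -/
inductive DervL : Bool → Bool → List Fm0 → Fm0 → Prop
  | id (w cf : Bool) (A : Fm0) : DervL w cf [A] A
  | one_r (w cf : Bool) : DervL w cf [] Fm0.one
  | rdiv_l (w cf : Bool) (Γ Δ₁ Δ₂ : List Fm0) (B C D : Fm0) :
      DervL w cf Γ B → DervL w cf (Δ₁ ++ C :: Δ₂) D →
      DervL w cf (Δ₁ ++ Fm0.rdiv C B :: (Γ ++ Δ₂)) D
  | rdiv_r (w cf : Bool) (Γ : List Fm0) (B C : Fm0) :
      DervL w cf (Γ ++ [B]) C → DervL w cf Γ (Fm0.rdiv C B)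
  | ldiv_l (w cf : Bool) (Γ Δ₁ Δ₂ : List Fm0) (A C D : Fm0) :
      DervL w cf Γ A → DervL w cf (Δ₁ ++ C :: Δ₂) D →
      DervL w cf (Δ₁ ++ Γ ++ Fm0.ldiv A C :: Δ₂) D
  | ldiv_r (w cf : Bool) (Γ : List Fm0) (A C : Fm0) :
      DervL w cf (A :: Γ) C → DervL w cf Γ (Fm0.ldiv A C)
  | mul_l (w cf : Bool) (Δ₁ Δ₂ : List Fm0) (A B D : Fm0) :
      DervL w cf (Δ₁ ++ A :: B :: Δ₂) D → DervL w cf (Δ₁ ++ Fm0.mul A B :: Δ₂) D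
  | mul_r (w cf : Bool) (Γ₁ Γ₂ : List Fm0) (A B : Fm0) :
      DervL w cf Γ₁ A → DervL w cf Γ₂ B → DervL w cf (Γ₁ ++ Γ₂) (Fm0.mul A B)
  | one_l (w cf : Bool) (Δ₁ Δ₂ : List Fm0) (A : Fm0) :
      DervL w cf (Δ₁ ++ Δ₂) A → DervL w cf (Δ₁ ++ Fm0.one :: Δ₂) A
  | bang_l (w cf : Bool) (Δ₁ Δ₂ : List Fm0) (A B : Fm0) :
      DervL w cf (Δ₁ ++ A :: Δ₂) B → DervL w cf (Δ₁ ++ Fm0.bang A :: Δ₂) B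
  | bang_r (w cf : Bool) (Φ : List Fm0) (A : Fm0) :
      DervL w cf (Φ.map Fm0.bang) A → DervL w cf (Φ.map Fm0.bang) (Fm0.bang A)
  | perm1 (w cf : Bool) (Δ₁ Γ Δ₂ : List Fm0) (A B : Fm0) :
      DervL w cf (Δ₁ ++ Fm0.bang A :: (Γ ++ Δ₂)) B →
      DervL w cf (Δ₁ ++ Γ ++ Fm0.bang A :: Δ₂) B
  | perm2 (w cf : Bool) (Δ₁ Γ Δ₂ : List Fm0) (A B : Fm0) :
      DervL w cf (Δ₁ ++ Γ ++ Fm0.bang A :: Δ₂) B →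
      DervL w cf (Δ₁ ++ Fm0.bang A :: (Γ ++ Δ₂)) B
  | contr (w cf : Bool) (Δ₁ Δ₂ : List Fm0) (A B : Fm0) :
      DervL w cf (Δ₁ ++ Fm0.bang A :: Fm0.bang A :: Δ₂) B →
      DervL w cf (Δ₁ ++ Fm0.bang A :: Δ₂) B
  | weak (cf : Bool) (Δ₁ Δ₂ : List Fm0) (A B : Fm0) :
      DervL true cf (Δ₁ ++ Δ₂) B → DervL true cf (Δ₁ ++ Fm0.bang A :: Δ₂) B
  | cut (w : Bool) (Θ Δ₁ Δ₂ : List Fm0) (A C : Fm0) :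
      DervL w true Θ A → DervL w true (Δ₁ ++ A :: Δ₂) C →
      DervL w true (Δ₁ ++ Θ ++ Δ₂) C

/-! ## The Lambek calculus with unit `L1` and theories `L1 + T` -/

/-- Formulae of `L1` (no `!`, no bracket modalities). -/
inductive Fm1 : Type
  | var : ℕ → Fm1
  | one : Fm1
  | ldiv : Fm1 → Fm1 → Fm1
  | rdiv : Fm1 → Fm1 → Fm1
  | mul : Fm1 → Fm1 → Fm1

/-- Sequents of `L1`. -/
abbrev Seq1 := List Fm1 × Fm1

/-- Derivability in `L1 + T` (sequents of `T` are extra axioms). -/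
inductive DervT (T : Set Seq1) : List Fm1 → Fm1 → Prop
  | id (A : Fm1) : DervT T [A] A
  | one_r : DervT T [] Fm1.one
  | ax (Γ : List Fm1) (A : Fm1) : (Γ, A) ∈ T → DervT T Γ A
  | rdiv_l (Γ Δ₁ Δ₂ : List Fm1) (B C D : Fm1) :
      DervT T Γ B → DervT T (Δ₁ ++ C :: Δ₂) D →
      DervT T (Δ₁ ++ Fm1.rdiv C B :: (Γ ++ Δ₂)) D
  | rdiv_r (Γ : List Fm1) (B C : Fm1) :
      DervT T (Γ ++ [B]) C → DervT T Γ (Fm1.rdiv C B)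
  | ldiv_l (Γ Δ₁ Δ₂ : List Fm1) (A C D : Fm1) :
      DervT T Γ A → DervT T (Δ₁ ++ C :: Δ₂) D →
      DervT T (Δ₁ ++ Γ ++ Fm1.ldiv A C :: Δ₂) D
  | ldiv_r (Γ : List Fm1) (A C : Fm1) :
      DervT T (A :: Γ) C → DervT T Γ (Fm1.ldiv A C)
  | mul_l (Δ₁ Δ₂ : List Fm1) (A B D : Fm1) :
      DervT T (Δ₁ ++ A :: B :: Δ₂) D → DervT T (Δ₁ ++ Fm1.mul A B :: Δ₂) D
  | mul_r (Γ₁ Γ₂ : List Fm1) (A B : Fm1) :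
      DervT T Γ₁ A → DervT T Γ₂ B → DervT T (Γ₁ ++ Γ₂) (Fm1.mul A B)
  | one_l (Δ₁ Δ₂ : List Fm1) (A : Fm1) :
      DervT T (Δ₁ ++ Δ₂) A → DervT T (Δ₁ ++ Fm1.one :: Δ₂) A
  | cut (Θ Δ₁ Δ₂ : List Fm1) (A C : Fm1) :
      DervT T Θ A → DervT T (Δ₁ ++ A :: Δ₂) C →
      DervT T (Δ₁ ++ Θ ++ Δ₂) C

/-- Derivability in `L1 + T` where every application of (cut) must have a
sequent from `T` as one of its premises. -/
inductive DervTr (T : Set Seq1) : List Fm1 → Fm1 → Prop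
  | id (A : Fm1) : DervTr T [A] A
  | one_r : DervTr T [] Fm1.one
  | ax (Γ : List Fm1) (A : Fm1) : (Γ, A) ∈ T → DervTr T Γ A
  | rdiv_l (Γ Δ₁ Δ₂ : List Fm1) (B C D : Fm1) :
      DervTr T Γ B → DervTr T (Δ₁ ++ C :: Δ₂) D →
      DervTr T (Δ₁ ++ Fm1.rdiv C B :: (Γ ++ Δ₂)) D
  | rdiv_r (Γ : List Fm1) (B C : Fm1) :
      DervTr T (Γ ++ [B]) C → DervTr T Γ (Fm1.rdiv C B)
  | ldiv_l (Γ Δ₁ Δ₂ : List Fm1) (A C D : Fm1) :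
      DervTr T Γ A → DervTr T (Δ₁ ++ C :: Δ₂) D →
      DervTr T (Δ₁ ++ Γ ++ Fm1.ldiv A C :: Δ₂) D
  | ldiv_r (Γ : List Fm1) (A C : Fm1) :
      DervTr T (A :: Γ) C → DervTr T Γ (Fm1.ldiv A C)
  | mul_l (Δ₁ Δ₂ : List Fm1) (A B D : Fm1) :
      DervTr T (Δ₁ ++ A :: B :: Δ₂) D → DervTr T (Δ₁ ++ Fm1.mul A B :: Δ₂) D
  | mul_r (Γ₁ Γ₂ : List Fm1) (A B : Fm1) :
      DervTr T Γ₁ A → DervTr T Γ₂ B → DervTr T (Γ₁ ++ Γ₂) (Fm1.mul A B)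
  | one_l (Δ₁ Δ₂ : List Fm1) (A : Fm1) :
      DervTr T (Δ₁ ++ Δ₂) A → DervTr T (Δ₁ ++ Fm1.one :: Δ₂) A
  | cut (Θ Δ₁ Δ₂ : List Fm1) (A C : Fm1) :
      (Θ, A) ∈ T ∨ (Δ₁ ++ A :: Δ₂, C) ∈ T →
      DervTr T Θ A → DervTr T (Δ₁ ++ A :: Δ₂) C →
      DervTr T (Δ₁ ++ Θ ++ Δ₂) C

/-- Derivability in `L1 + T` by a derivation all of whose sequents satisfy
the predicate `Good`. -/
inductive DervTgood (T : Set Seq1) (Good : List Fm1 → Fm1 → Prop) : List Fm1 → Fm1 → Prop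
  | id (A : Fm1) : Good [A] A → DervTgood T Good [A] A
  | one_r : Good [] Fm1.one → DervTgood T Good [] Fm1.one
  | ax (Γ : List Fm1) (A : Fm1) : (Γ, A) ∈ T → Good Γ A → DervTgood T Good Γ A
  | rdiv_l (Γ Δ₁ Δ₂ : List Fm1) (B C D : Fm1) :
      DervTgood T Good Γ B → DervTgood T Good (Δ₁ ++ C :: Δ₂) D →
      Good (Δ₁ ++ Fm1.rdiv C B :: (Γ ++ Δ₂)) D →
      DervTgood T Good (Δ₁ ++ Fm1.rdiv C B :: (Γ ++ Δ₂)) D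
  | rdiv_r (Γ : List Fm1) (B C : Fm1) :
      DervTgood T Good (Γ ++ [B]) C → Good Γ (Fm1.rdiv C B) →
      DervTgood T Good Γ (Fm1.rdiv C B)
  | ldiv_l (Γ Δ₁ Δ₂ : List Fm1) (A C D : Fm1) :
      DervTgood T Good Γ A → DervTgood T Good (Δ₁ ++ C :: Δ₂) D →
      Good (Δ₁ ++ Γ ++ Fm1.ldiv A C :: Δ₂) D →
      DervTgood T Good (Δ₁ ++ Γ ++ Fm1.ldiv A C :: Δ₂) D
  | ldiv_r (Γ : List Fm1) (A C : Fm1) :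
      DervTgood T Good (A :: Γ) C → Good Γ (Fm1.ldiv A C) →
      DervTgood T Good Γ (Fm1.ldiv A C)
  | mul_l (Δ₁ Δ₂ : List Fm1) (A B D : Fm1) :
      DervTgood T Good (Δ₁ ++ A :: B :: Δ₂) D →
      Good (Δ₁ ++ Fm1.mul A B :: Δ₂) D →
      DervTgood T Good (Δ₁ ++ Fm1.mul A B :: Δ₂) D
  | mul_r (Γ₁ Γ₂ : List Fm1) (A B : Fm1) :
      DervTgood T Good Γ₁ A → DervTgood T Good Γ₂ B →
      Good (Γ₁ ++ Γ₂) (Fm1.mul A B) →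
      DervTgood T Good (Γ₁ ++ Γ₂) (Fm1.mul A B)
  | one_l (Δ₁ Δ₂ : List Fm1) (A : Fm1) :
      DervTgood T Good (Δ₁ ++ Δ₂) A → Good (Δ₁ ++ Fm1.one :: Δ₂) A →
      DervTgood T Good (Δ₁ ++ Fm1.one :: Δ₂) A
  | cut (Θ Δ₁ Δ₂ : List Fm1) (A C : Fm1) :
      DervTgood T Good Θ A → DervTgood T Good (Δ₁ ++ A :: Δ₂) C →
      Good (Δ₁ ++ Θ ++ Δ₂) C →
      DervTgood T Good (Δ₁ ++ Θ ++ Δ₂) C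

/-- The formula is built from primitive types using only the product `·`. -/
def ProdOnly : Fm1 → Prop
  | Fm1.var _ => True
  | Fm1.mul A B => ProdOnly A ∧ ProdOnly B
  | _ => False

/-- A sequent contains no occurrences of `\`, `/`, `1`. -/
def ProdOnlySeq (Γ : List Fm1) (A : Fm1) : Prop :=
  (∀ F ∈ Γ, ProdOnly F) ∧ ProdOnly A

/-! ## The bracket-forgetting projection -/

/-- BFP on formulae: delete all `⟨⟩` and `[]⁻¹`. -/
def fmBFP : Fm → Fm0
  | Fm.var n => Fm0.var n
  | Fm.one => Fm0.one
  | Fm.ldiv A B => Fm0.ldiv (fmBFP A) (fmBFP B)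
  | Fm.rdiv A B => Fm0.rdiv (fmBFP A) (fmBFP B)
  | Fm.mul A B => Fm0.mul (fmBFP A) (fmBFP B)
  | Fm.dia A => fmBFP A
  | Fm.binv A => fmBFP A
  | Fm.bang A => Fm0.bang (fmBFP A)

mutual
  /-- BFP on items. -/
  def itemBFP : Item → List Fm0
    | Item.fm A => [fmBFP A]
    | Item.br Γ => metaBFP Γ
  /-- BFP on meta-formulae: delete all brackets. -/
  def metaBFP : List Item → List Fm0
    | [] => []
    | i :: Γ => itemBFP i ++ metaBFP Γ
end

/-! ## Generative grammars (semi-Thue systems) -/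

/-- A generative grammar (semi-Thue system) over symbols coded by `ℕ`. -/
structure Grammar where
  nonterminals : Finset ℕ
  terminals : Finset ℕ
  disj : Disjoint nonterminals terminals
  start : ℕ
  start_mem : start ∈ nonterminals
  prods : Finset (List ℕ × List ℕ)
  prods_wf : ∀ p ∈ prods,
    (∀ c ∈ p.1, c ∈ nonterminals ∪ terminals) ∧
    (∀ c ∈ p.2, c ∈ nonterminals ∪ terminals)

/-- One rewriting step `η α θ ⇒_G η β θ`. -/
def Grammar.Step (G : Grammar) (x y : List ℕ) : Prop :=
  ∃ p ∈ G.prods, ∃ η θ : List ℕ, x = η ++ p.1 ++ θ ∧ y = η ++ p.2 ++ θ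

/-- `⇒*_G`: reflexive-transitive closure of `⇒_G`. -/
def Grammar.Derives (G : Grammar) : List ℕ → List ℕ → Prop :=
  Relation.ReflTransGen G.Step

/-- All productions of `G` have nonempty left- and right-hand sides. -/
def Grammar.NonemptySides (G : Grammar) : Prop :=
  ∀ p ∈ G.prods, p.1 ≠ [] ∧ p.2 ≠ []

/-! ### Encoding grammars into formulae -/

/-- `u₁ · … · u_k` as an `Fm`-formula (`1` for the empty word). -/
def wordFm : List ℕ → Fm
  | [] => Fm.one
  | [a] => Fm.var a
  | a :: b :: rest => Fm.mul (Fm.var a) (wordFm (b :: rest))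

/-- `u₁ · … · u_k` as an `Fm0`-formula. -/
def wordFm0 : List ℕ → Fm0
  | [] => Fm0.one
  | [a] => Fm0.var a
  | a :: b :: rest => Fm0.mul (Fm0.var a) (wordFm0 (b :: rest))

/-- `u₁ · … · u_k` as an `Fm1`-formula. -/
def wordFm1 : List ℕ → Fm1
  | [] => Fm1.one
  | [a] => Fm1.var a
  | a :: b :: rest => Fm1.mul (Fm1.var a) (wordFm1 (b :: rest))

/-- The formula `(u₁·…·u_k) / (v₁·…·v_m)` for a production `u ⇒ v`, in `Fm`. -/
def prodFm (p : List ℕ × List ℕ) : Fm := Fm.rdiv (wordFm p.1) (wordFm p.2)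

/-- The formula `(u₁·…·u_k) / (v₁·…·v_m)` for a production `u ⇒ v`, in `Fm0`. -/
def prodFm0 (p : List ℕ × List ℕ) : Fm0 := Fm0.rdiv (wordFm0 p.1) (wordFm0 p.2)

/-- `Γ_G = !B₁, …, !Bₙ` (bracket-free). -/
noncomputable def GammaG (G : Grammar) : List Fm0 :=
  G.prods.toList.map (fun p => Fm0.bang (prodFm0 p))

/-- `Φ_G = !(1 / !B₁), …, !(1 / !Bₙ)` (bracket-free). -/
noncomputable def PhiG (G : Grammar) : List Fm0 :=
  G.prods.toList.map (fun p => Fm0.bang (Fm0.rdiv Fm0.one (Fm0.bang (prodFm0 p))))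

/-- `Γ̃_G = ![]⁻¹B₁, …, ![]⁻¹Bₙ`. -/
noncomputable def GammaTG (G : Grammar) : Meta :=
  G.prods.toList.map (fun p => Item.fm (Fm.bang (Fm.binv (prodFm p))))

/-- `Φ̃_G = !(1 / ![]⁻¹B₁), …, !(1 / ![]⁻¹Bₙ)`. -/
noncomputable def PhiTG (G : Grammar) : Meta :=
  G.prods.toList.map
    (fun p => Item.fm (Fm.bang (Fm.rdiv Fm.one (Fm.bang (Fm.binv (prodFm p))))))

/-- The theory `T_G = { v₁, …, v_m → u₁·…·u_k : (u ⇒ v) ∈ P }`. -/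
def TG (G : Grammar) : Set Seq1 :=
  { q | ∃ p ∈ G.prods, q = (p.2.map Fm1.var, wordFm1 p.1) }

/-! ## Effective encodings of sequents into `ℕ` -/

/-- An effective injective code of `!bL1`-formulae. -/
def encFm : Fm → ℕ
  | Fm.var n => Nat.pair 0 n
  | Fm.one => Nat.pair 1 0
  | Fm.ldiv A B => Nat.pair 2 (Nat.pair (encFm A) (encFm B))
  | Fm.rdiv A B => Nat.pair 3 (Nat.pair (encFm A) (encFm B))
  | Fm.mul A B => Nat.pair 4 (Nat.pair (encFm A) (encFm B))
  | Fm.dia A => Nat.pair 5 (encFm A)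
  | Fm.binv A => Nat.pair 6 (encFm A)
  | Fm.bang A => Nat.pair 7 (encFm A)

mutual
  /-- An effective injective code of items. -/
  def encItem : Item → ℕ
    | Item.fm A => Nat.pair 0 (encFm A)
    | Item.br Γ => Nat.pair 1 (encMeta Γ)
  /-- An effective injective code of meta-formulae. -/
  def encMeta : List Item → ℕ
    | [] => 0
    | i :: Γ => Nat.pair (encItem i) (encMeta Γ) + 1
end

/-- An effective injective code of `!bL1`-sequents. -/
def encSeqB (Γ : Meta) (A : Fm) : ℕ := Nat.pair (encMeta Γ) (encFm A)

/-- An effective injective code of bracket-free formulae. -/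
def encFm0 : Fm0 → ℕ
  | Fm0.var n => Nat.pair 0 n
  | Fm0.one => Nat.pair 1 0
  | Fm0.ldiv A B => Nat.pair 2 (Nat.pair (encFm0 A) (encFm0 B))
  | Fm0.rdiv A B => Nat.pair 3 (Nat.pair (encFm0 A) (encFm0 B))
  | Fm0.mul A B => Nat.pair 4 (Nat.pair (encFm0 A) (encFm0 B))
  | Fm0.bang A => Nat.pair 5 (encFm0 A)

/-- An effective injective code of `!L1`/`!wL1`-sequents. -/
def encSeq0 (Γ : List Fm0) (A : Fm0) : ℕ :=
  Nat.pair ((Γ.map encFm0).foldr (fun a r => Nat.pair a r + 1) 0) (encFm0 A)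

/-! ## Sizes -/

/-- Size (number of symbols) of a formula. -/
def fmSize : Fm → ℕ
  | Fm.var _ => 1
  | Fm.one => 1
  | Fm.ldiv A B => fmSize A + fmSize B + 1
  | Fm.rdiv A B => fmSize A + fmSize B + 1
  | Fm.mul A B => fmSize A + fmSize B + 1
  | Fm.dia A => fmSize A + 1
  | Fm.binv A => fmSize A + 1
  | Fm.bang A => fmSize A + 1

mutual
  /-- Size of an item. -/
  def itemSize : Item → ℕ
    | Item.fm A => fmSize A
    | Item.br Γ => metaSize Γ + 1
  /-- Size of a meta-formula. -/
  def metaSize : List Item → ℕ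
    | [] => 0
    | i :: Γ => itemSize i + metaSize Γ
end

/-! ## Polarity and the bracket non-negative condition -/

/-- `cleanFm pol A`: the formula `A`, all of whose subformula occurrences have
their polarity in the sequent tracked starting from `pol` (`true` = positive),
contains no `[]⁻¹`-subformula at positive polarity and no `⟨⟩`-subformula at
negative polarity. -/
def cleanFm : Bool → Fm → Prop
  | _, Fm.var _ => True
  | _, Fm.one => True
  | pol, Fm.ldiv A B => cleanFm (!pol) A ∧ cleanFm pol B
  | pol, Fm.rdiv B A => cleanFm pol B ∧ cleanFm (!pol) A
  | pol, Fm.mul A B => cleanFm pol A ∧ cleanFm pol B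
  | pol, Fm.dia A => pol = true ∧ cleanFm pol A
  | pol, Fm.binv A => pol = false ∧ cleanFm pol A
  | pol, Fm.bang A => cleanFm pol A

/-- `bnnFm pol A`: every negative occurrence of a `!`-subformula of `A`
(where `A` itself occurs at polarity `pol` in the sequent) includes no
positive occurrence of `[]⁻¹C` and no negative occurrence of `⟨⟩C`. -/
def bnnFm : Bool → Fm → Prop
  | _, Fm.var _ => True
  | _, Fm.one => True
  | pol, Fm.ldiv A B => bnnFm (!pol) A ∧ bnnFm pol B
  | pol, Fm.rdiv B A => bnnFm pol B ∧ bnnFm (!pol) A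
  | pol, Fm.mul A B => bnnFm pol A ∧ bnnFm pol B
  | pol, Fm.dia A => bnnFm pol A
  | pol, Fm.binv A => bnnFm pol A
  | pol, Fm.bang A => (pol = false → cleanFm false A) ∧ bnnFm pol A

mutual
  /-- The bracket non-negative condition for an item of an antecedent. -/
  def bnnItem : Item → Prop
    | Item.fm A => bnnFm false A
    | Item.br Γ => bnnMeta Γ
  /-- The bracket non-negative condition for an antecedent. -/
  def bnnMeta : List Item → Prop
    | [] => True
    | i :: Γ => bnnItem i ∧ bnnMeta Γ
end

/-- The sequent `Γ → C` obeys the bracket non-negative condition. -/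
def bnnSeq (Γ : Meta) (C : Fm) : Prop := bnnMeta Γ ∧ bnnFm true C

/-! ## The formulation of `!bL1` with the generalized permutation rule -/

/-- `interleave Δ₀ [(A₁,Δ₁), …, (A_k,Δ_k)] = Δ₀, !A₁, Δ₁, …, !A_k, Δ_k`. -/
def interleave : Meta → List (Fm × Meta) → Meta
  | Δ₀, [] => Δ₀
  | Δ₀, (A, Δ) :: rest => Δ₀ ++ Item.fm (Fm.bang A) :: interleave Δ rest

/-- Derivations in the formulation of `!bL1` in which `(perm₁)`, `(perm₂)` are
replaced by the generalized permutation rule `(perm)*`.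
`NDervP cf b n Γ C` means: there is a derivation of `Γ → C` in which
(cut) is allowed only if `cf = true`, no two applications of `(perm)*` are
consecutive, `b` records whether the last rule applied is `(perm)*`, and the
derivation has exactly `n` rule applications (axiom instances included). -/
inductive NDervP : Bool → Bool → ℕ → Meta → Fm → Prop
  | id (cf : Bool) (A : Fm) : NDervP cf false 1 [Item.fm A] A
  | one_r (cf : Bool) : NDervP cf false 1 [] Fm.one
  | rdiv_l (cf b₁ b₂ : Bool) (n₁ n₂ : ℕ) (Δ : Ctx) (Γ : Meta) (B C D : Fm) :
      NDervP cf b₁ n₁ Γ B → NDervP cf b₂ n₂ (Δ.fill [Item.fm C]) D →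
      NDervP cf false (n₁ + n₂ + 1) (Δ.fill (Item.fm (Fm.rdiv C B) :: Γ)) D
  | rdiv_r (cf b : Bool) (n : ℕ) (Γ : Meta) (B C : Fm) :
      NDervP cf b n (Γ ++ [Item.fm B]) C → NDervP cf false (n + 1) Γ (Fm.rdiv C B)
  | ldiv_l (cf b₁ b₂ : Bool) (n₁ n₂ : ℕ) (Δ : Ctx) (Γ : Meta) (A C D : Fm) :
      NDervP cf b₁ n₁ Γ A → NDervP cf b₂ n₂ (Δ.fill [Item.fm C]) D →
      NDervP cf false (n₁ + n₂ + 1) (Δ.fill (Γ ++ [Item.fm (Fm.ldiv A C)])) D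
  | ldiv_r (cf b : Bool) (n : ℕ) (Γ : Meta) (A C : Fm) :
      NDervP cf b n (Item.fm A :: Γ) C → NDervP cf false (n + 1) Γ (Fm.ldiv A C)
  | mul_l (cf b : Bool) (n : ℕ) (Δ : Ctx) (A B D : Fm) :
      NDervP cf b n (Δ.fill [Item.fm A, Item.fm B]) D →
      NDervP cf false (n + 1) (Δ.fill [Item.fm (Fm.mul A B)]) D
  | mul_r (cf b₁ b₂ : Bool) (n₁ n₂ : ℕ) (Γ₁ Γ₂ : Meta) (A B : Fm) :
      NDervP cf b₁ n₁ Γ₁ A → NDervP cf b₂ n₂ Γ₂ B →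
      NDervP cf false (n₁ + n₂ + 1) (Γ₁ ++ Γ₂) (Fm.mul A B)
  | one_l (cf b : Bool) (n : ℕ) (Δ : Ctx) (A : Fm) :
      NDervP cf b n (Δ.fill []) A → NDervP cf false (n + 1) (Δ.fill [Item.fm Fm.one]) A
  | dia_l (cf b : Bool) (n : ℕ) (Δ : Ctx) (A C : Fm) :
      NDervP cf b n (Δ.fill [Item.br [Item.fm A]]) C →
      NDervP cf false (n + 1) (Δ.fill [Item.fm (Fm.dia A)]) C
  | dia_r (cf b : Bool) (n : ℕ) (Θ : Meta) (A : Fm) :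
      NDervP cf b n Θ A → NDervP cf false (n + 1) [Item.br Θ] (Fm.dia A)
  | binv_l (cf b : Bool) (n : ℕ) (Δ : Ctx) (A C : Fm) :
      NDervP cf b n (Δ.fill [Item.fm A]) C →
      NDervP cf false (n + 1) (Δ.fill [Item.br [Item.fm (Fm.binv A)]]) C
  | binv_r (cf b : Bool) (n : ℕ) (Θ : Meta) (A : Fm) :
      NDervP cf b n [Item.br Θ] A → NDervP cf false (n + 1) Θ (Fm.binv A)
  | bang_l (cf b : Bool) (n : ℕ) (Δ : Ctx) (A B : Fm) :
      NDervP cf b n (Δ.fill [Item.fm A]) B →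
      NDervP cf false (n + 1) (Δ.fill [Item.fm (Fm.bang A)]) B
  | bang_r (cf b : Bool) (n : ℕ) (Φ : List Fm) (A : Fm) :
      NDervP cf b n (bangs Φ) A → NDervP cf false (n + 1) (bangs Φ) (Fm.bang A)
  | contr (cf b : Bool) (n : ℕ) (Δ : Ctx) (Φ : List Fm) (Γ : Meta) (B : Fm) :
      Φ ≠ [] →
      NDervP cf b n (Δ.fill (bangs Φ ++ [Item.br (bangs Φ ++ Γ)])) B →
      NDervP cf false (n + 1) (Δ.fill (bangs Φ ++ Γ)) B
  | permStar (cf : Bool) (n : ℕ) (Δ : Ctx) (Δ₀ : Meta) (L L' : List (Fm × Meta)) (C : Fm) :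
      L.map Prod.snd = L'.map Prod.snd →
      (L.map Prod.fst).Perm (L'.map Prod.fst) →
      NDervP cf false n (Δ.fill (interleave Δ₀ L)) C →
      NDervP cf true (n + 1) (Δ.fill (interleave Δ₀ L')) C
  | cut (b₁ b₂ : Bool) (n₁ n₂ : ℕ) (Δ : Ctx) (Θ : Meta) (A C : Fm) :
      NDervP true b₁ n₁ Θ A → NDervP true b₂ n₂ (Δ.fill [Item.fm A]) C →
      NDervP true false (n₁ + n₂ + 1) (Δ.fill Θ) C

/-! ## Semi-Thue systems over an arbitrary alphabet -/

/-- One rewriting step of the semi-Thue system with productions `P`. -/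
def Rewrites {A : Type*} (P : Set (List A × List A)) (x y : List A) : Prop :=
  ∃ p ∈ P, ∃ η θ : List A, x = η ++ p.1 ++ θ ∧ y = η ++ p.2 ++ θ

/-- The grammar obtained from a finite semi-Thue system by coding its letters as numbers.
The only nonterminal symbol is the starting one. -/
noncomputable def Grammar.ofRewriting {A : Type*} [Finite A] (P : Set (List A × List A))
    (hP : P.Finite) (s : A) (e : A → ℕ) (he : e.Injective) : Grammar where
  nonterminals := {e s}
  terminals := (Set.toFinite (e '' {s}ᶜ)).toFinset
  disj := by simp [he.eq_iff]
  start := e s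
  start_mem := by simp
  prods := (hP.image (Prod.map (List.map e) (List.map e))).toFinset
  prods_wf := by
    have key (a : A) : e a ∈ {e s} ∪ (Set.toFinite (e '' {s}ᶜ)).toFinset := by
      simp [he.eq_iff, em]
    intro p hp
    simp only [Set.Finite.mem_toFinset, Set.mem_image] at hp
    obtain ⟨q, -, rfl⟩ := hp
    simp only [Prod.map_fst, Prod.map_snd, List.forall_mem_map]
    exact ⟨fun a _ => key a, fun a _ => key a⟩

section ofRewriting

variable {A : Type*} [Finite A] {P : Set (List A × List A)} (hP : P.Finite) (s : A) {e : A → ℕ}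
  (he : e.Injective)

theorem Grammar.ofRewriting_step_map {x y : List A} (h : Rewrites P x y) :
    (Grammar.ofRewriting P hP s e he).Step (x.map e) (y.map e) := by
  obtain ⟨p, hp, η, θ, rfl, rfl⟩ := h
  exact ⟨(p.1.map e, p.2.map e), by simpa [ofRewriting] using ⟨p.1, p.2, hp, rfl, rfl⟩,
    η.map e, θ.map e, by simp, by simp⟩

theorem Grammar.exists_rewrites_of_ofRewriting_step {x : List A} {y : List ℕ}
    (h : (Grammar.ofRewriting P hP s e he).Step (x.map e) y) :
    ∃ z, y = z.map e ∧ Rewrites P x z := by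
  obtain ⟨p, hp, η, θ, hx, rfl⟩ := h
  simp only [ofRewriting, Set.Finite.mem_toFinset, Set.mem_image] at hp
  obtain ⟨q, hq, rfl⟩ := hp
  obtain ⟨u, θ, rfl, hu, rfl⟩ := List.map_eq_append_iff.1 hx
  obtain ⟨η, v, rfl, rfl, hv⟩ := List.map_eq_append_iff.1 hu
  cases (List.map_injective_iff.2 he) hv
  exact ⟨η ++ q.2 ++ θ, by simp, q, hq, η, θ, rfl, rfl⟩

theorem Grammar.ofRewriting_derives_map {x y : List A} :
    (Grammar.ofRewriting P hP s e he).Derives (x.map e) (y.map e) ↔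
      Relation.ReflTransGen (Rewrites P) x y := by
  refine ⟨fun h => ?_, fun h =>
    Relation.ReflTransGen.lift (List.map e) (fun _ _ => ofRewriting_step_map hP s he) _ _ h⟩
  suffices ∀ w, (Grammar.ofRewriting P hP s e he).Derives (x.map e) w →
      ∃ z, w = z.map e ∧ Relation.ReflTransGen (Rewrites P) x z by
    obtain ⟨z, hz, h⟩ := this _ h
    rwa [List.map_injective_iff.2 he hz]
  intro w h
  induction h with
  | refl => exact ⟨x, rfl, .refl⟩
  | tail _ hstep ih =>
    obtain ⟨z, rfl, hz⟩ := ih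
    obtain ⟨z', rfl, hz'⟩ := exists_rewrites_of_ofRewriting_step hP s he hstep
    exact ⟨z', rfl, hz.tail hz'⟩

theorem Grammar.ofRewriting_mem_language {w : List A} (hw : s ∉ w) :
    ((∀ c ∈ w.map e, c ∈ (Grammar.ofRewriting P hP s e he).terminals) ∧
      (Grammar.ofRewriting P hP s e he).Derives [(Grammar.ofRewriting P hP s e he).start]
        (w.map e)) ↔ Relation.ReflTransGen (Rewrites P) [s] w := by
  rw [← ofRewriting_derives_map hP s he, List.map_singleton]
  refine and_iff_right ?_
  simp only [ofRewriting, Set.Finite.mem_toFinset, List.forall_mem_map]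
  exact fun a ha => ⟨a, fun h => hw (h ▸ ha), rfl⟩

theorem Grammar.ofRewriting_nonemptySides (h : ∀ p ∈ P, p.1 ≠ [] ∧ p.2 ≠ []) :
    (Grammar.ofRewriting P hP s e he).NonemptySides := by
  intro p hp
  simp only [ofRewriting, Set.Finite.mem_toFinset, Set.mem_image] at hp
  obtain ⟨q, hq, rfl⟩ := hp
  simpa using h q hq

end ofRewriting

/-! ## Running a Turing machine backwards -/

open Turing

/-- Symbols of the semi-Thue system attached to a Turing machine with tape alphabet `Γ` and
set of states `Q`. -/
inductive TapeSymbol (Γ Q : Type*)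
  | start
  | halted
  | leftEnd
  | rightEnd
  | cell (a : Γ)
  | state (q : Q)

namespace TapeSymbol

instance {Γ Q : Type*} [Finite Γ] [Finite Q] : Finite (TapeSymbol Γ Q) := by
  let f : TapeSymbol Γ Q → Fin 4 ⊕ Γ ⊕ Q
    | start => .inl 0
    | halted => .inl 1
    | leftEnd => .inl 2
    | rightEnd => .inl 3
    | cell a => .inr (.inl a)
    | state q => .inr (.inr q)
  refine Finite.of_injective f fun x y h => ?_
  cases x <;> cases y <;> simp_all [f]

/-- The word coding the configuration with state `q`, whose tape holds `l` (read leftwards) to the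
left of the head and `r` to the right of it, the scanned cell included. -/
def config {Γ Q : Type*} (l : List Γ) (q : Q) (r : List Γ) : List (TapeSymbol Γ Q) :=
  leftEnd :: l.reverse.map cell ++ state q :: (r.map cell ++ [rightEnd])

theorem start_notMem_config {Γ Q : Type*} (l : List Γ) (q : Q) (r : List Γ) :
    start ∉ config l q r := by
  simp [config]

theorem halted_notMem_config {Γ Q : Type*} (l : List Γ) (q : Q) (r : List Γ) :
    halted ∉ config l q r := by
  simp [config]

theorem eq_of_append_state_eq_config {Γ Q : Type*} {l r : List Γ} {p q : Q}
    {η θ : List (TapeSymbol Γ Q)} (h : η ++ state p :: θ = config l q r) :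
    η = leftEnd :: l.reverse.map cell ∧ p = q ∧ θ = r.map cell ++ [rightEnd] := by
  rw [config, eq_comm, List.append_cons_inj_of_notMem (by simp) (by simp)] at h
  obtain ⟨rfl, h, rfl⟩ := h
  exact ⟨rfl, (state.inj h).symm, rfl⟩

theorem exists_cons_of_cell_cons_eq {Γ Q : Type*} {a : Γ} {r : List Γ}
    {θ : List (TapeSymbol Γ Q)} (h : cell a :: θ = r.map cell ++ [rightEnd]) :
    ∃ r', r = a :: r' ∧ θ = r'.map cell ++ [rightEnd] := by
  cases r <;> simp_all

theorem exists_cons_of_append_cell_eq {Γ Q : Type*} {a : Γ} {l : List Γ}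
    {η : List (TapeSymbol Γ Q)} (h : η ++ [cell a] = leftEnd :: l.reverse.map cell) :
    ∃ l', l = a :: l' ∧ η = leftEnd :: l'.reverse.map cell := by
  cases l with
  | nil => simpa using congrArg List.getLast? h
  | cons b l =>
    rw [List.reverse_cons, List.map_append, ← List.cons_append] at h
    obtain ⟨rfl, h⟩ := List.append_inj' h rfl
    exact ⟨l, by simpa using h.symm, rfl⟩

end TapeSymbol

open TapeSymbol

/-- The productions running the machine `M`, restricted to the states in `S`, backwards from a
halting configuration. -/
inductive BackwardRule {Γ Λ : Type*} [Inhabited Γ] [Inhabited Λ] (M : TM0.Machine Γ Λ)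
    (S : Set Λ) : List (TapeSymbol Γ S) → List (TapeSymbol Γ S) → Prop
  | start : BackwardRule M S [start] [leftEnd, halted, rightEnd]
  | cellLeft (a : Γ) : BackwardRule M S [halted] [cell a, halted]
  | cellRight (a : Γ) : BackwardRule M S [halted] [halted, cell a]
  | halt (q : S) (a : Γ) (h : M q a = none) : BackwardRule M S [halted] [state q, cell a]
  | write (q q' : S) (a b : Γ) (h : M q a = some (q'.1, .write b)) :
      BackwardRule M S [state q', cell b] [state q, cell a]
  | moveRight (q q' : S) (a : Γ) (h : M q a = some (q'.1, .move .right)) :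
      BackwardRule M S [cell a, state q'] [state q, cell a]
  | moveLeft (q q' : S) (a c : Γ) (h : M q a = some (q'.1, .move .left)) :
      BackwardRule M S [state q', cell c, cell a] [cell c, state q, cell a]
  | blankLeft : BackwardRule M S [leftEnd, cell default] [leftEnd]
  | blankRight : BackwardRule M S [cell default, rightEnd] [rightEnd]

/-- The set of pairs related by `BackwardRule`. -/
def backwardRules {Γ Λ : Type*} [Inhabited Γ] [Inhabited Λ] (M : TM0.Machine Γ Λ)
    (S : Set Λ) : Set (List (TapeSymbol Γ S) × List (TapeSymbol Γ S)) :=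
  {p | BackwardRule M S p.1 p.2}

theorem listBlank_mk_append_default {Γ : Type*} [Inhabited Γ] (l : List Γ) :
    ListBlank.mk (l ++ [default]) = ListBlank.mk l :=
  Eq.symm (Quotient.sound' (Or.inl ⟨1, rfl⟩))

theorem tape_mk₂_append_default_left {Γ : Type*} [Inhabited Γ] (l r : List Γ) :
    Tape.mk₂ (l ++ [default]) r = Tape.mk₂ l r := by
  rw [Tape.mk₂, listBlank_mk_append_default, Tape.mk₂]

theorem tape_mk₂_append_default_right {Γ : Type*} [Inhabited Γ] (l r : List Γ) :
    Tape.mk₂ l (r ++ [default]) = Tape.mk₂ l r := by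
  rw [Tape.mk₂, listBlank_mk_append_default, Tape.mk₂]

section BackwardRule

variable {Γ Λ : Type*} [Inhabited Γ] [Inhabited Λ] (M : TM0.Machine Γ Λ) {S : Set Λ}

theorem backwardRules_nonempty : ∀ p ∈ backwardRules M S, p.1 ≠ [] ∧ p.2 ≠ [] := by
  rintro ⟨x, y⟩ (h : BackwardRule M S x y)
  cases h <;> simp

theorem backwardRules_finite [Finite Γ] (hS : S.Finite) : (backwardRules M S).Finite := by
  have := hS.to_subtype
  refine ((List.finite_length_le (TapeSymbol Γ S) 3).prod
    (List.finite_length_le (TapeSymbol Γ S) 3)).subset ?_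
  rintro ⟨x, y⟩ (h : BackwardRule M S x y)
  cases h <;> simp

variable {M}

theorem halts_of_step {c c' : TM0.Cfg Γ Λ} (h : TM0.step M c = some c')
    (hc : (StateTransition.eval (TM0.step M) c').Dom) :
    (StateTransition.eval (TM0.step M) c).Dom := by
  rwa [StateTransition.reaches_eval (Relation.ReflTransGen.single h)]

theorem halts_of_rewrites {l r : List Γ} {q : S} {x : List (TapeSymbol Γ S)}
    (hx : ∀ l (q : S) r, x = config l q r →
      (StateTransition.eval (TM0.step M) ⟨q, Tape.mk₂ l r⟩).Dom)
    (h : Rewrites (backwardRules M S) x (config l q r)) :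
    (StateTransition.eval (TM0.step M) ⟨q, Tape.mk₂ l r⟩).Dom := by
  obtain ⟨⟨α, β⟩, hp, η, θ, rfl, h⟩ := h
  replace hp : BackwardRule M S α β := hp
  have halted_mem : halted ∉ η ++ β ++ θ := h ▸ halted_notMem_config l q r
  cases hp with
  | start => simp at halted_mem
  | cellLeft a => simp at halted_mem
  | cellRight a => simp at halted_mem
  | halt p a hM =>
    obtain ⟨rfl, rfl, hθ⟩ := eq_of_append_state_eq_config (by simpa using h.symm)
    obtain ⟨r, rfl, rfl⟩ := exists_cons_of_cell_cons_eq hθ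
    exact Part.dom_iff_mem.2 ⟨_, StateTransition.mem_eval.2
      ⟨.refl, by simp [TM0.step, Tape.mk₂, hM]⟩⟩
  | write p p' a b hM =>
    obtain ⟨rfl, rfl, hθ⟩ := eq_of_append_state_eq_config (by simpa using h.symm)
    obtain ⟨r, rfl, rfl⟩ := exists_cons_of_cell_cons_eq hθ
    exact halts_of_step (by simp [TM0.step, Tape.mk₂, hM])
      (hx l p' (b :: r) (by simp [config]))
  | moveRight p p' a hM =>
    obtain ⟨rfl, rfl, hθ⟩ := eq_of_append_state_eq_config (by simpa using h.symm)
    obtain ⟨r, rfl, rfl⟩ := exists_cons_of_cell_cons_eq hθ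
    exact halts_of_step (by simp [TM0.step, Tape.mk₂, hM])
      (hx (a :: l) p' r (by simp [config]))
  | moveLeft p p' a c hM =>
    obtain ⟨hη, rfl, hθ⟩ := eq_of_append_state_eq_config (η := η ++ [cell c])
      (by simpa using h.symm)
    obtain ⟨r, rfl, rfl⟩ := exists_cons_of_cell_cons_eq hθ
    obtain ⟨l, rfl, rfl⟩ := exists_cons_of_append_cell_eq hη
    exact halts_of_step (by simp [TM0.step, Tape.mk₂, hM])
      (hx l p' (c :: a :: r) (by simp [config]))
  | blankLeft =>
    have h' : [] ++ leftEnd :: (l.reverse.map cell ++ state q :: (r.map cell ++ [rightEnd])) =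
      η ++ leftEnd :: θ := by simpa [config] using h
    rw [List.append_cons_inj_of_notMem (by simp) (by simp)] at h'
    obtain ⟨rfl, -, rfl⟩ := h'
    rw [← tape_mk₂_append_default_left]
    exact hx (l ++ [default]) q r (by simp [config])
  | blankRight =>
    have h' : (leftEnd :: l.reverse.map cell ++ state q :: r.map cell) ++ rightEnd :: [] =
      η ++ rightEnd :: θ := by simpa [config] using h
    rw [List.append_cons_inj_of_notMem (by simp) (by simp)] at h'
    obtain ⟨rfl, -, rfl⟩ := h'
    rw [← tape_mk₂_append_default_right]
    exact hx l q (r ++ [default]) (by simp [config])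

theorem halts_of_derives {l r : List Γ} {q : S}
    (h : Relation.ReflTransGen (Rewrites (backwardRules M S)) [start] (config l q r)) :
    (StateTransition.eval (TM0.step M) ⟨q, Tape.mk₂ l r⟩).Dom := by
  suffices ∀ x, Relation.ReflTransGen (Rewrites (backwardRules M S)) [start] x →
      ∀ l (q : S) r, x = config l q r →
        (StateTransition.eval (TM0.step M) ⟨q, Tape.mk₂ l r⟩).Dom from this _ h l q r rfl
  intro x h
  induction h with
  | refl => exact fun l q r h => absurd (h ▸ List.mem_singleton_self _) (start_notMem_config l q r)
  | tail _ hstep ih =>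
    rintro l q r rfl
    exact halts_of_rewrites ih hstep

theorem BackwardRule.rewrites {α β : List (TapeSymbol Γ S)} (h : BackwardRule M S α β)
    (η θ : List (TapeSymbol Γ S)) : Rewrites (backwardRules M S) (η ++ α ++ θ) (η ++ β ++ θ) :=
  ⟨(α, β), h, η, θ, rfl, rfl⟩

theorem derives_halted (l r : List Γ) :
    Relation.ReflTransGen (Rewrites (backwardRules M S)) [start]
      (leftEnd :: l.reverse.map cell ++ halted :: (r.map cell ++ [rightEnd])) := by
  induction r with
  | nil =>
    induction l with
    | nil => exact .single (by simpa using BackwardRule.start.rewrites [] [])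
    | cons a l ih =>
      have := (BackwardRule.cellLeft a : BackwardRule M S _ _).rewrites
        (leftEnd :: l.reverse.map cell) [rightEnd]
      exact ih.tail (by simpa using this)
  | cons a r ih =>
    have := (BackwardRule.cellRight a : BackwardRule M S _ _).rewrites
      (leftEnd :: l.reverse.map cell) (r.map cell ++ [rightEnd])
    exact ih.tail (by simpa using this)

theorem derives_config_of_blank_left {l r : List Γ} {q : S}
    (h : Relation.ReflTransGen (Rewrites (backwardRules M S)) [start]
      (config (l ++ [default]) q r)) :
    Relation.ReflTransGen (Rewrites (backwardRules M S)) [start] (config l q r) := by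
  have := (BackwardRule.blankLeft : BackwardRule M S _ _).rewrites []
    (l.reverse.map cell ++ state q :: (r.map cell ++ [rightEnd]))
  exact h.tail (by simpa [config] using this)

theorem derives_config_of_blank_right {l r : List Γ} {q : S}
    (h : Relation.ReflTransGen (Rewrites (backwardRules M S)) [start]
      (config l q (r ++ [default]))) :
    Relation.ReflTransGen (Rewrites (backwardRules M S)) [start] (config l q r) := by
  have := (BackwardRule.blankRight : BackwardRule M S _ _).rewrites
    (leftEnd :: l.reverse.map cell ++ state q :: r.map cell) []
  exact h.tail (by simpa [config] using this)

theorem derives_config_of_step_eq_none (l r : List Γ) (q : S)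
    (h : TM0.step M ⟨q, Tape.mk₂ l r⟩ = none) :
    Relation.ReflTransGen (Rewrites (backwardRules M S)) [start] (config l q r) := by
  cases r with
  | nil =>
    rw [← tape_mk₂_append_default_right] at h
    exact derives_config_of_blank_right (derives_config_of_step_eq_none l _ q h)
  | cons a r =>
    have := (BackwardRule.halt q a (by simpa [TM0.step, Tape.mk₂] using h)).rewrites
      (leftEnd :: l.reverse.map cell) (r.map cell ++ [rightEnd])
    exact (derives_halted l r).tail (by simpa [config] using this)
termination_by 1 - r.length

theorem derives_config_of_step_eq_some (hM : TM0.Supports M S) {q : S} {c : TM0.Cfg Γ Λ}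
    (ih : ∀ (hc : c.q ∈ S) (l r : List Γ), c.Tape = Tape.mk₂ l r →
      Relation.ReflTransGen (Rewrites (backwardRules M S)) [start] (config l ⟨c.q, hc⟩ r))
    (l r : List Γ) (h : TM0.step M ⟨q, Tape.mk₂ l r⟩ = some c) :
    Relation.ReflTransGen (Rewrites (backwardRules M S)) [start] (config l q r) := by
  have hc : c.q ∈ S := TM0.step_supports M hM h q.2
  cases r with
  | nil =>
    rw [← tape_mk₂_append_default_right] at h
    exact derives_config_of_blank_right (derives_config_of_step_eq_some hM ih l _ h)
  | cons a r =>
    simp only [TM0.step, Tape.mk₂, Tape.mk'_head, ListBlank.head_mk, List.headI_cons,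
      Option.map_eq_some_iff, Prod.exists] at h
    obtain ⟨q', s, hs, rfl⟩ := h
    match s, hs with
    | .write b, hs =>
      have := (BackwardRule.write q ⟨q', hc⟩ a b hs).rewrites
        (leftEnd :: l.reverse.map cell) (r.map cell ++ [rightEnd])
      exact (ih hc l (b :: r) (by simp [Tape.mk₂])).tail (by simpa [config] using this)
    | .move .right, hs =>
      have := (BackwardRule.moveRight q ⟨q', hc⟩ a hs).rewrites
        (leftEnd :: l.reverse.map cell) (r.map cell ++ [rightEnd])
      exact (ih hc (a :: l) r (by simp [Tape.mk₂])).tail (by simpa [config] using this)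
    | .move .left, hs =>
      have derives_cons (b : Γ) (l' : List Γ)
          (h : (Tape.mk₂ l (a :: r)).move .left = Tape.mk₂ l' (b :: a :: r)) :
          Relation.ReflTransGen (Rewrites (backwardRules M S)) [start]
            (config (b :: l') q (a :: r)) := by
        have := (BackwardRule.moveLeft q ⟨q', hc⟩ a b hs).rewrites
          (leftEnd :: l'.reverse.map cell) (r.map cell ++ [rightEnd])
        exact (ih hc l' (b :: a :: r) h).tail (by simpa [config] using this)
      cases l with
      | nil => exact derives_config_of_blank_left (derives_cons default [] (by simp [Tape.mk₂]))
      | cons b l => exact derives_cons b l (by simp [Tape.mk₂])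
termination_by 1 - r.length

theorem derives_of_reaches (hM : TM0.Supports M S) {c c' : TM0.Cfg Γ Λ}
    (h : StateTransition.Reaches (TM0.step M) c c') (hc' : TM0.step M c' = none) :
    ∀ (hc : c.q ∈ S) (l r : List Γ), c.Tape = Tape.mk₂ l r →
      Relation.ReflTransGen (Rewrites (backwardRules M S)) [start] (config l ⟨c.q, hc⟩ r) := by
  induction h using Relation.ReflTransGen.head_induction_on with
  | refl =>
    obtain ⟨q, T⟩ := c'
    rintro hq l r rfl
    exact derives_config_of_step_eq_none l r ⟨q, hq⟩ hc'
  | @head c d hstep _ ih =>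
    obtain ⟨q, T⟩ := c
    rintro hq l r rfl
    exact derives_config_of_step_eq_some hM ih l r hstep

end BackwardRule

theorem exists_grammar_of_supports {Γ Λ : Type*} [Inhabited Γ] [Finite Γ] [Inhabited Λ]
    (M : TM0.Machine Γ Λ) {S : Set Λ} (hS : S.Finite) (hM : TM0.Supports M S) :
    ∃ G : Grammar, G.NonemptySides ∧ ∃ e : TapeSymbol Γ S → ℕ, ∀ l : List Γ,
      ((∀ c ∈ (config [] (⟨default, hM.1⟩ : S) l).map e, c ∈ G.terminals) ∧
        G.Derives [G.start] ((config [] (⟨default, hM.1⟩ : S) l).map e)) ↔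
      (TM0.eval M l).Dom := by
  have := hS.to_subtype
  obtain ⟨e, he⟩ := Countable.exists_injective_nat (TapeSymbol Γ S)
  refine ⟨.ofRewriting _ (backwardRules_finite M hS) start e he,
    Grammar.ofRewriting_nonemptySides _ _ he (backwardRules_nonempty M), e, fun l => ?_⟩
  rw [Grammar.ofRewriting_mem_language _ _ he (start_notMem_config _ _ _)]
  change _ ↔ (StateTransition.eval (TM0.step M) ⟨default, Tape.mk₂ [] l⟩).Dom
  refine ⟨halts_of_derives, fun h => ?_⟩
  obtain ⟨c, hc⟩ := Part.dom_iff_mem.1 h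
  obtain ⟨hreach, hnone⟩ := StateTransition.mem_eval.1 hc
  exact derives_of_reaches hM hreach hnone hM.1 [] l rfl

/-! ## Turing machines for partial recursive functions -/

open Turing.PartrecToTM2 in
theorem trList_two_pow (m : ℕ) :
    trList [2 ^ m] = List.replicate m Γ'.bit0 ++ [Γ'.bit1, Γ'.cons] := by
  have key : ∃ p : PosNum, ((2 ^ m : ℕ) : Num) = .pos p ∧
      trPosNum p = List.replicate m Γ'.bit0 ++ [Γ'.bit1] := by
    induction m with
    | zero => exact ⟨.one, by simp; rfl, rfl⟩
    | succ m ih =>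
      obtain ⟨p, hp, htr⟩ := ih
      refine ⟨p.bit0, ?_, by rw [trPosNum, htr, List.replicate_succ, List.cons_append]⟩
      rw [pow_succ, mul_two, Nat.cast_add, hp, Num.bit0_of_bit0, Num.bit0]
  obtain ⟨p, hp, htr⟩ := key
  simp [trList, trNat, hp, trNum, htr]

open Turing.PartrecToTM2 in
theorem exists_machine_of_partrec {f : ℕ →. ℕ} (hf : Partrec f) :
    ∃ (Λ : Type) (_ : Inhabited Λ)
      (M : TM0.Machine (TM2to1.Γ' K' fun _ => Turing.PartrecToTM2.Γ') Λ) (S : Set Λ),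
      S.Finite ∧ TM0.Supports M S ∧
      ∀ n, (TM0.eval M (TM2to1.trInit K'.main (trList [n]))).Dom ↔ (f n).Dom := by
  obtain ⟨c, hc⟩ := ToPartrec.Code.exists_code (Nat.Partrec'.part_iff₁.2 hf)
  let _ : Inhabited Λ' := ⟨trNormal c Cont'.halt⟩
  refine ⟨_, inferInstance, TM1to0.tr (TM2to1.tr tr), _, Finset.finite_toSet _,
    TM1to0.tr_supports _ (TM2to1.tr_supports _ (tr_supports c Cont'.halt)), fun n => ?_⟩
  rw [TM1to0.tr_eval]
  refine (TM2to1.tr_eval_dom (M := tr) K'.main (trList [n])).trans ?_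
  have hinit : (TM2.init K'.main (trList [n]) : TM2.Cfg (fun _ : K' => Γ') Λ' (Option Γ')) =
      init c [n] := by
    unfold TM2.init init
    congr 1
    funext k
    cases k <;> rfl
  change (StateTransition.eval (TM2.step tr) (TM2.init K'.main (trList [n]))).Dom ↔ _
  rw [hinit, tr_eval]
  have := hc ⟨[n], rfl⟩
  simp at this
  rw [this]
  rfl

theorem partrec_eval_of_two_pow :
    ∃ f : ℕ →. ℕ, Partrec f ∧ ∀ c : Nat.Partrec.Code,
      (f (2 ^ Encodable.encode c)).Dom ↔ (c.eval 0).Dom := by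
  refine ⟨fun n => (Nat.rfind fun m => (Part.some (decide (2 ^ m = n)) : Part Bool)).bind fun m =>
    (Denumerable.ofNat Nat.Partrec.Code m).eval 0, ?_, fun c => ?_⟩
  · have hpow : Primrec fun m : ℕ => 2 ^ m :=
      (Primrec₂.unpaired'.1 Nat.Primrec.pow).comp (Primrec.const 2) Primrec.id
    have hdec : Computable fun p : ℕ × ℕ => decide (2 ^ p.2 = p.1) :=
      (Primrec.eq.comp (hpow.comp Primrec.snd) Primrec.fst).decide.to_comp
    exact Partrec.bind (Partrec.rfind hdec.partrec) (Nat.Partrec.Code.eval_part.comp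
      ((Computable.ofNat _).comp Computable.snd) (Computable.const 0))
  · have h : Encodable.encode c ∈ Nat.rfind fun m =>
        (Part.some (decide (2 ^ m = 2 ^ Encodable.encode c)) : Part Bool) :=
      Nat.mem_rfind.2 ⟨by simp, fun h => by simpa using h.ne⟩
    simp only [Part.eq_some_iff.2 h, Part.bind_some, Denumerable.ofNat_encode]

open Turing.PartrecToTM2 in
theorem exists_trInit_trList_two_pow :
    ∃ (u : List (TM2to1.Γ' K' fun _ => Γ')) (a : TM2to1.Γ' K' fun _ => Γ'), ∀ m,
      TM2to1.trInit K'.main (trList [2 ^ m]) = u ++ List.replicate m a := by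
  let g (b : Γ') : K' → Option Γ' := Function.update (fun _ => none) .main (some b)
  refine ⟨[(true, g .cons), (false, g .bit1)], (false, g .bit0), fun m => ?_⟩
  have hrev : (trList [2 ^ m]).reverse = [.cons, .bit1] ++ List.replicate m Γ'.bit0 := by
    rw [trList_two_pow]
    simp
  rw [TM2to1.trInit, hrev]
  exact congrArg ([(true, g .cons), (false, g .bit1)] ++ ·) List.map_replicate

open Turing.PartrecToTM2 in
instance : Finite K' :=
  Finite.of_surjective (![.main, .rev, .aux, .stack] : Fin 4 → K') fun k => by
    cases k
    exacts [⟨0, rfl⟩, ⟨1, rfl⟩, ⟨2, rfl⟩, ⟨3, rfl⟩]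

/-- There exists a generative grammar, with nonempty-sided
productions, generating an algorithmically undecidable language. -/
theorem exists_undecidable_grammar :
    ∃ G : Grammar, G.NonemptySides ∧
      ¬ ComputablePred (fun ω : List ℕ =>
        (∀ c ∈ ω, c ∈ G.terminals) ∧ G.Derives [G.start] ω) := by
  obtain ⟨f, hf, hfc⟩ := partrec_eval_of_two_pow
  obtain ⟨Λ, _, M, S, hS, hM, hMf⟩ := exists_machine_of_partrec hf
  have : Finite (TM2to1.Γ' Turing.PartrecToTM2.K' fun _ => Turing.PartrecToTM2.Γ') :=
    inferInstanceAs (Finite (Bool × _))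
  obtain ⟨G, hG, e, he⟩ := exists_grammar_of_supports M hS hM
  obtain ⟨u, a, hu⟩ := exists_trInit_trList_two_pow
  refine ⟨G, hG, fun hcomp => ComputablePred.halting_problem 0 ?_⟩
  refine ComputablePred.computable_of_manyOneReducible ⟨fun c =>
    (config [] (⟨default, hM.1⟩ : S)
      (TM2to1.trInit .main (Turing.PartrecToTM2.trList [2 ^ Encodable.encode c]))).map e, ?_,
    fun c => ((he _).trans ((hMf _).trans (hfc c))).symm⟩ hcomp
  simp only [hu, config, List.map_append, List.map_cons, List.map_replicate, List.append_assoc]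
  have hrep : Primrec fun c : Nat.Partrec.Code =>
      List.replicate (Encodable.encode c) (e (cell a)) := by
    simpa using Primrec.list_map (Primrec.list_range.comp Primrec.encode)
      (Primrec.const (e (cell a))).to₂
  exact (Primrec.list_append.comp (Primrec.const _) (Primrec.list_cons.comp (Primrec.const _)
    (Primrec.list_append.comp (Primrec.const _)
      (Primrec.list_append.comp hrep (Primrec.const _))))).to_comp

end Lambek
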